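/- Let s, t be integers with L ≥ s > 0 and L > t ≥ 0, let Ψ ∈ ℝ^{n_0 × n_L}, and let Φ_{pq} ∈ ℝ for 1 ≤ p ≤ n_s, 1 ≤ q ≤ n_t. If Σ_{p=1}^{n_s} Σ_{q=1}^{n_t} Φ_{pq} · (𝐖^(s,0) · Ψ · 𝐖^(L,t))_{pq} = 0 in R, then either Φ_{pq} = 0 for all p, q, or Ψ = 0. -/

import Mathlib

open Matrix MvPolynomial

noncomputable section

/-- Indeterminates: `Sum.inl (i, j, k)` is `x^(i)_{jk}` and `Sum.inr (i, j)` is `y^(i)_j`. -/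
abbrev PVar : Type := (ℕ × ℕ × ℕ) ⊕ (ℕ × ℕ)

/-- The polynomial ring `R` with real coefficients in the indeterminates
`x^(i)_{jk}` and `y^(i)_j`. -/
abbrev Rpoly : Type := MvPolynomial PVar ℝ

/-- The matrix `𝐖^(i)` of indeterminates, with `(j,k)` entry `x^(i)_{jk}`. -/
def Wm (n : ℕ → ℕ) (i : ℕ) : Matrix (Fin (n i)) (Fin (n (i - 1))) Rpoly :=
  Matrix.of fun j k => MvPolynomial.X (Sum.inl (i, (j : ℕ), (k : ℕ)))

/-- The column vector `𝐛^(i)` of indeterminates, with `j`-th entry `y^(i)_j`. -/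
def bm (n : ℕ → ℕ) (i : ℕ) : Matrix (Fin (n i)) (Fin 1) Rpoly :=
  Matrix.of fun j _ => MvPolynomial.X (Sum.inr (i, (j : ℕ)))

/-- The product `𝐖^(s,t) = 𝐖^(s) * 𝐖^(s-1) * ⋯ * 𝐖^(t+1)` of `s - t` matrices. -/
def WmProd (n : ℕ → ℕ) : (s : ℕ) → (t : ℕ) → Matrix (Fin (n s)) (Fin (n t)) Rpoly
  | s, t =>
    if _h : t < s then Wm n s * WmProd n (s - 1) t
    else Matrix.of fun i j => if (i : ℕ) = (j : ℕ) then (1 : Rpoly) else 0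
termination_by s t => s
decreasing_by omega

/-- The entrywise inclusion of a real matrix into matrices over `R`. -/
def toR {m k : Type*} (M : Matrix m k ℝ) : Matrix m k Rpoly :=
  M.map (MvPolynomial.C)

/-- The `j`-th coordinate of a generic vector `u_i`. -/
def colVar (i j : ℕ) : Rpoly := X (Sum.inr (i, j))

/-- The `k`-th coordinate of a generic vector `v_i`, independent of `u_i`. -/
def rowVar (i k : ℕ) : Rpoly := X (Sum.inl (i, k, 0))

/-- The substitution replacing each `𝐖^(i)` by the generic rank-one matrix `u_i v_{i-1}ᵀ`. -/
def rankOneSubst : Rpoly →ₐ[ℝ] Rpoly :=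
  aeval (Sum.elim (fun x => colVar x.1 x.2.1 * rowVar (x.1 - 1) x.2.2) (fun _ => 0))

theorem rankOneSubst_Wm_succ (n : ℕ → ℕ) (i : ℕ) (j : Fin (n (i + 1))) (k : Fin (n i)) :
    rankOneSubst (Wm n (i + 1) j k) = colVar (i + 1) j * rowVar i k := by
  simp [rankOneSubst, Wm]

theorem sum_rowVar_mul_colVar_ne_zero {m : ℕ} (hm : 1 ≤ m) (i : ℕ) :
    ∑ j : Fin m, rowVar i j * colVar i j ≠ 0 := by
  intro h
  have := congrArg (eval fun _ => (1 : ℝ)) h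
  simp [rowVar, colVar] at this
  omega

theorem WmProd_self (n : ℕ → ℕ) (t : ℕ) : WmProd n t t = 1 := by
  rw [WmProd]
  ext i j
  simp [Matrix.one_apply, Fin.ext_iff]

theorem WmProd_succ_apply (n : ℕ → ℕ) {s t : ℕ} (h : t ≤ s) (p : Fin (n (s + 1)))
    (q : Fin (n t)) :
    WmProd n (s + 1) t p q = ∑ j : Fin (n s), Wm n (s + 1) p j * WmProd n s t j q := by
  rw [WmProd, dif_pos (Nat.lt_succ_of_le h)]
  rfl

/-- Under the rank-one substitution, `𝐖^(s,t)` becomes a nonzero multiple of `u_s v_tᵀ`. -/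
theorem exists_rankOneSubst_WmProd (n : ℕ → ℕ) (hn : ∀ i, 1 ≤ n i) {s t : ℕ} (h : t < s) :
    ∃ c : Rpoly, c ≠ 0 ∧
      ∀ p q, rankOneSubst (WmProd n s t p q) = c * (colVar s p * rowVar t q) := by
  induction s, h using Nat.le_induction with
  | base =>
    refine ⟨1, one_ne_zero, fun p q => ?_⟩
    simp [WmProd_succ_apply n le_rfl, WmProd_self, Matrix.one_apply, rankOneSubst_Wm_succ]
  | succ s h ih =>
    obtain ⟨c, hc, hcs⟩ := ih
    refine ⟨c * ∑ j : Fin (n s), rowVar s j * colVar s j,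
      mul_ne_zero hc (sum_rowVar_mul_colVar_ne_zero (hn s) s), fun p q => ?_⟩
    rw [WmProd_succ_apply n (Nat.le_of_succ_le h), map_sum, Finset.mul_sum,
      Finset.sum_mul]
    refine Finset.sum_congr rfl fun j _ => ?_
    rw [map_mul, rankOneSubst_Wm_succ, hcs]
    ring

/-- A bilinear form vanishing on a pair of generic vectors has zero coefficients. -/
theorem eq_zero_of_sum_colVar_rowVar {m k : ℕ} (i j : ℕ) (A : Fin m → Fin k → ℝ)
    (h : ∑ p, ∑ q, C (A p q) * (colVar i p * rowVar j q) = 0) (p : Fin m) (q : Fin k) :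
    A p q = 0 := by
  have := congrArg (eval (Sum.elim (fun x => if x.2.1 = (q : ℕ) then (1 : ℝ) else 0)
    (fun x => if x.2 = (p : ℕ) then 1 else 0))) h
  simpa [colVar, rowVar, ← Fin.ext_iff, Finset.sum_ite_eq'] using this

/-- Lemma on `[𝐖𝐖]` terms. -/
theorem phi_or_psi_eq_zero_of_WW_combination (L : ℕ) (hL : 1 ≤ L) (n : ℕ → ℕ)
    (hn : ∀ i, 1 ≤ n i)
    (s t : ℕ) (hs : 0 < s) (hsL : s ≤ L) (htL : t < L)
    (Ψ : Matrix (Fin (n 0)) (Fin (n L)) ℝ)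
    (Φ : Fin (n s) → Fin (n t) → ℝ)
    (h : (∑ p, ∑ q, MvPolynomial.C (Φ p q) *
        (WmProd n s 0 * toR Ψ * WmProd n L t) p q) = (0 : Rpoly)) :
    (∀ p q, Φ p q = 0) ∨ Ψ = 0 := by
  obtain ⟨c, hc, hcs⟩ := exists_rankOneSubst_WmProd n hn hs
  obtain ⟨d, hd, hds⟩ := exists_rankOneSubst_WmProd n hn htL
  have hΨ (a b) : rankOneSubst (toR Ψ a b) = C (Ψ a b) := by
    simp [toR, rankOneSubst, algebraMap_eq]
  have hΦ (p q) : rankOneSubst (C (Φ p q)) = C (Φ p q) := by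
    simp [rankOneSubst, algebraMap_eq]
  have hfactor : c * d * ((∑ p, ∑ q, C (Φ p q) * (colVar s p * rowVar t q)) *
      ∑ b, ∑ a, C (Ψᵀ b a) * (colVar L b * rowVar 0 a)) = 0 := by
    rw [← map_zero rankOneSubst, ← h]
    rw [Finset.sum_mul, Finset.mul_sum, map_sum]
    refine Finset.sum_congr rfl fun p _ => ?_
    rw [Finset.sum_mul, Finset.mul_sum, map_sum]
    refine Finset.sum_congr rfl fun q _ => ?_
    simp only [map_sum, map_mul, Matrix.mul_apply, hcs, hds, hΨ, hΦ, Matrix.transpose_apply,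
      Finset.mul_sum, Finset.sum_mul]
    refine Finset.sum_congr rfl fun b _ => Finset.sum_congr rfl fun a _ => ?_
    ring
  rcases mul_eq_zero.mp ((mul_eq_zero.mp hfactor).resolve_left (mul_ne_zero hc hd)) with h | h
  · exact Or.inl (eq_zero_of_sum_colVar_rowVar s t Φ h)
  · refine Or.inr (Matrix.ext fun a b => ?_)
    exact eq_zero_of_sum_colVar_rowVar L 0 Ψᵀ h b a
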